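/- Under the stated hypotheses, and assuming additionally that β(t) → +∞ as t → +∞, one has liminf_{t→∞} φ(x(t)) ≥ φ(z) for every z ∈ S. -/

import Mathlib

open Filter MeasureTheory Set RealInnerProductSpace

section
variable {H : Type*} [NormedAddCommGroup H] [InnerProductSpace ℝ H] [CompleteSpace H]

/-- The gradient inequality for a convex function. -/
theorem ConvexOn.add_inner_gradient_le {f : H → ℝ} (hf : ConvexOn ℝ univ f)
    (hd : Differentiable ℝ f) (u v : H) : f u + ⟪gradient f u, v - u⟫ ≤ f v := by
  have hg : ConvexOn ℝ univ (fun t : ℝ => f (AffineMap.lineMap u v t)) := by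
    simpa [Function.comp_def] using hf.comp_affineMap (AffineMap.lineMap u v)
  have hderiv : HasDerivAt (fun t : ℝ => f (AffineMap.lineMap u v t))
      ⟪gradient f u, v - u⟫ 0 := by
    have h1 : HasFDerivAt f (InnerProductSpace.toDual ℝ H (gradient f u))
        (AffineMap.lineMap u v (0 : ℝ)) := by
      simpa using (hd u).hasGradientAt.hasFDerivAt
    simpa [Function.comp_def] using h1.comp_hasDerivAt (0 : ℝ) AffineMap.hasDerivAt_lineMap
  have h := hg.le_slope_of_hasDerivAt (mem_univ 0) (mem_univ 1) one_pos hderiv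
  simp only [slope_def_field, AffineMap.lineMap_apply_one, AffineMap.lineMap_apply_zero, sub_zero,
    div_one] at h
  linarith

/-- First-order optimality: at a minimizer over the zero set of a nonnegative convex function,
the opposite of the gradient lies in the normal cone. -/
theorem inner_gradient_nonneg_of_isMinOn_zeros {φ ψ : H → ℝ} (hψ : ConvexOn ℝ univ ψ)
    (hψ0 : ∀ y, 0 ≤ ψ y) (hφ : Differentiable ℝ φ) {z : H} (hz : ψ z = 0)
    (hmin : ∀ y, ψ y = 0 → φ z ≤ φ y) {y : H} (hy : ψ y = 0) :
    0 ≤ ⟪gradient φ z, y - z⟫ := by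
  have hconv : Convex ℝ {y | ψ y = 0} := by
    have : {y | ψ y = 0} = {y ∈ univ | ψ y ≤ 0} := by
      ext w
      simp [le_antisymm_iff, hψ0 w]
    rw [this]
    exact hψ.convex_le 0
  have hloc : IsLocalMinOn φ {y | ψ y = 0} z :=
    IsMinOn.localize (fun y hy => hmin y hy)
  have := hloc.hasFDerivWithinAt_nonneg
    ((hφ z).hasGradientAt.hasFDerivAt.hasFDerivWithinAt)
    (sub_mem_posTangentConeAt_of_segment_subset (hconv.segment_subset hz hy))
  simpa using this

end

/-- If `g'` is bounded above by a positive multiple of `f` and the positive part of `f` has finite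
integral, then `g` is bounded above. -/
theorem exists_forall_le_of_hasDerivWithinAt_le {g g' f : ℝ → ℝ} {c : ℝ} (hc : 0 ≤ c)
    (hg : ∀ t ∈ Ici (0 : ℝ), HasDerivWithinAt g (g' t) (Ici 0) t)
    (hf : ContinuousOn f (Ici 0)) (hle : ∀ t ∈ Ici (0 : ℝ), g' t ≤ c * f t)
    (hfin : ∫⁻ t in Ici (0 : ℝ), ENNReal.ofReal (f t) ≠ ⊤) :
    ∃ C, ∀ t ∈ Ici (0 : ℝ), g t ≤ C := by
  refine ⟨g 0 + c * (∫⁻ t in Ici (0 : ℝ), ENNReal.ofReal (f t)).toReal, fun T hT => ?_⟩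
  have hT : 0 ≤ T := hT
  have hfT : ContinuousOn f (Icc 0 T) := hf.mono Icc_subset_Ici_self
  have hint : IntegrableOn f (Icc 0 T) := hfT.integrableOn_Icc
  have h1 : g T - g 0 ≤ ∫ t in (0 : ℝ)..T, c * f t :=
    intervalIntegral.sub_le_integral_of_hasDeriv_right_of_le hT
      (fun t ht => ((hg t ht.1).continuousWithinAt).mono Icc_subset_Ici_self)
      (fun t ht => (hg t ht.1.le).mono fun s hs => (ht.1.trans hs).le)
      (hint.const_mul c) (fun t ht => hle t ht.1.le)
  rw [intervalIntegral.integral_const_mul, intervalIntegral.integral_of_le hT] at h1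
  have h2 : ∫ t in Ioc 0 T, f t ≤ (∫⁻ t in Ici (0 : ℝ), ENNReal.ofReal (f t)).toReal := by
    rw [integral_eq_lintegral_pos_part_sub_lintegral_neg_part
      (hint.mono_set Ioc_subset_Icc_self)]
    have h3 : (∫⁻ t in Ioc 0 T, ENNReal.ofReal (f t)).toReal ≤
        (∫⁻ t in Ici (0 : ℝ), ENNReal.ofReal (f t)).toReal :=
      ENNReal.toReal_mono hfin (lintegral_mono_set fun t ht => ht.1.le)
    linarith [ENNReal.toReal_nonneg (a := ∫⁻ t in Ioc 0 T, ENNReal.ofReal (-f t))]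
  linarith [mul_le_mul_of_nonneg_left h2 hc]

/-- A nonnegative function with finite integral over a half-line takes arbitrarily small values. -/
theorem exists_lt_of_lintegral_Ici_ne_top {M : ℝ → ENNReal}
    (hM : ∫⁻ t in Ici (0 : ℝ), M t ≠ ⊤) {ε : ℝ} (hε : 0 < ε) :
    ∃ t ∈ Ici (0 : ℝ), M t < ENNReal.ofReal ε := by
  by_contra! hcon
  apply hM
  rw [eq_top_iff]
  calc (⊤ : ENNReal) = ∫⁻ _ in Ici (0 : ℝ), ENNReal.ofReal ε := by
        simp [ENNReal.mul_top, hε]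
    _ ≤ ∫⁻ t in Ici (0 : ℝ), M t := setLIntegral_mono' measurableSet_Ici hcon

theorem stmt17 {H : Type*} [NormedAddCommGroup H] [InnerProductSpace ℝ H] [CompleteSpace H]
    (φ ψ : H → ℝ) (γ k : ℝ) (β β' : ℝ → ℝ) (x x' x'' : ℝ → H)
    -- ψ is convex, Fréchet differentiable with Lipschitz continuous gradient,
    -- nonnegative, and argmin ψ = ψ⁻¹(0) is nonempty
    (hψconv : ConvexOn ℝ univ ψ)
    (hψdiff : Differentiable ℝ ψ)
    (hψlip : ∃ L : NNReal, LipschitzWith L (gradient ψ))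
    (hψnonneg : ∀ y, 0 ≤ ψ y)
    (hψmin : ∃ y, ψ y = 0)
    -- φ is convex, Fréchet differentiable with Lipschitz continuous gradient,
    -- bounded from below, and S = {z ∈ argmin ψ : φ z ≤ φ y ∀ y ∈ argmin ψ} is nonempty
    (hφconv : ConvexOn ℝ univ φ)
    (hφdiff : Differentiable ℝ φ)
    (hφlip : ∃ L : NNReal, LipschitzWith L (gradient φ))
    (hφbdd : BddBelow (range φ))
    (hS : ∃ z : H, ψ z = 0 ∧ ∀ y, ψ y = 0 → φ z ≤ φ y)
    -- γ > 0, 0 ≤ k < γ, and β : [0,∞) → (0,∞) is a C¹ function (with derivative β')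
    -- satisfying the growth condition 0 ≤ β' ≤ k β
    (hγ : 0 < γ) (hk : 0 ≤ k) (hkγ : k < γ)
    (hβpos : ∀ t ∈ Ici (0 : ℝ), 0 < β t)
    (hβderiv : ∀ t ∈ Ici (0 : ℝ), HasDerivWithinAt β (β' t) (Ici 0) t)
    (hβ'cont : ContinuousOn β' (Ici 0))
    (hβgrowth : ∀ t ∈ Ici (0 : ℝ), 0 ≤ β' t ∧ β' t ≤ k * β t)
    -- condition (H): for every p in the range of the normal cone to argmin ψ (i.e.
    -- p ∈ N(z) for some z ∈ argmin ψ = ψ⁻¹(0)), the integral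
    -- ∫_0^∞ β(t) [ψ*(p/β(t)) - σ(p/β(t))] dt is finite; here σ(p/β(t)) = ⟪p/β(t), z⟫
    -- since p ∈ N(z), and β(t)[ψ*(q) - ⟪q, z⟫] = ⨆ w, β(t)((⟪q, w⟫ - ψ w) - ⟪q, z⟫) ≥ 0.
    (hH : ∀ z p : H, ψ z = 0 → (∀ y, ψ y = 0 → ⟪p, y - z⟫ ≤ 0) →
      ∫⁻ t in Ici (0 : ℝ), ⨆ w : H,
        ENNReal.ofReal (β t * ((⟪(β t)⁻¹ • p, w⟫ - ψ w) - ⟪(β t)⁻¹ • p, z⟫)) ≠ ⊤)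
    -- x : [0,∞) → H is twice continuously differentiable (first derivative x',
    -- second derivative x'') and satisfies ẍ + γ ẋ + ∇φ(x) + β ∇ψ(x) = 0 on [0,∞)
    (hx' : ∀ t ∈ Ici (0 : ℝ), HasDerivWithinAt x (x' t) (Ici 0) t)
    (hx'' : ∀ t ∈ Ici (0 : ℝ), HasDerivWithinAt x' (x'' t) (Ici 0) t)
    (hx''cont : ContinuousOn x'' (Ici 0))
    (hode : ∀ t ∈ Ici (0 : ℝ),
      x'' t + γ • x' t + gradient φ (x t) + β t • gradient ψ (x t) = 0)
    -- β(t) → +∞ as t → +∞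
    (hβinf : Tendsto β atTop atTop) :
    ∀ z : H, (ψ z = 0 ∧ ∀ y, ψ y = 0 → φ z ≤ φ y) →
      ∀ ε > (0:ℝ), ∀ᶠ t in atTop, φ z - ε < φ (x t) := by
  rintro z ⟨hz, hzmin⟩ ε hε
  have hnormal : ∀ r : ℝ, 0 ≤ r → ∀ y, ψ y = 0 → ⟪r • -gradient φ z, y - z⟫ ≤ 0 := by
    intro r hr y hy
    have := inner_gradient_nonneg_of_isMinOn_zeros hψconv hψnonneg hφdiff hz hzmin hy
    rw [real_inner_smul_left, inner_neg_left, mul_neg]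
    exact neg_nonpos.2 (mul_nonneg hr this)
  have hexpr : ∀ (p w : H), ∀ t ∈ Ici (0 : ℝ),
      β t * ((⟪(β t)⁻¹ • p, w⟫ - ψ w) - ⟪(β t)⁻¹ • p, z⟫) = ⟪p, w - z⟫ - β t * ψ w := by
    intro p w t ht
    have := (hβpos t ht).ne'
    rw [real_inner_smul_left, real_inner_smul_left, inner_sub_right]
    field_simp
    ring
  obtain ⟨m, hm⟩ := hφbdd
  have hm : ∀ y, m ≤ φ y := fun y => hm (mem_range_self y)
  -- the penalty term `β ψ(x)` is bounded above
  obtain ⟨C, hC⟩ : ∃ C, ∀ t ∈ Ici (0 : ℝ), β t * ψ (x t) ≤ C := by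
    have hγk : 0 < γ + k := by linarith
    obtain ⟨a, ha0, haγ, hak⟩ : ∃ a : ℝ, 0 < a ∧ 1 ≤ a * γ ∧ a * k < 1 := by
      refine ⟨2 / (γ + k), by positivity, ?_, ?_⟩
      · rw [div_mul_eq_mul_div, le_div_iff₀ hγk]; linarith
      · rw [div_mul_eq_mul_div, div_lt_one hγk]; linarith
    have hδ : 0 < 1 - a * k := by linarith
    set q : H := (1 - a * k)⁻¹ • -gradient φ z with hq
    have hderiv : ∀ t ∈ Ici (0 : ℝ), HasDerivWithinAt
        (fun t => ⟪x' t, x t - z⟫ + γ / 2 * ⟪x t - z, x t - z⟫ +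
          a * (1 / 2 * ⟪x' t, x' t⟫ + φ (x t) + β t * ψ (x t)))
        ((⟪x' t, x' t⟫ + ⟪x'' t, x t - z⟫) + γ / 2 * (⟪x t - z, x' t⟫ + ⟪x' t, x t - z⟫) +
          a * (1 / 2 * (⟪x' t, x'' t⟫ + ⟪x'' t, x' t⟫) + ⟪gradient φ (x t), x' t⟫ +
            (β' t * ψ (x t) + β t * ⟪gradient ψ (x t), x' t⟫))) (Ici 0) t := by
      intro t ht
      have h1 := (hx' t ht).sub_const z
      have hφ' : HasDerivWithinAt (fun t => φ (x t)) ⟪gradient φ (x t), x' t⟫ (Ici 0) t := by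
        simpa [Function.comp_def] using
          (hφdiff (x t)).hasGradientAt.hasFDerivAt.comp_hasDerivWithinAt t (hx' t ht)
      have hψ' : HasDerivWithinAt (fun t => ψ (x t)) ⟪gradient ψ (x t), x' t⟫ (Ici 0) t := by
        simpa [Function.comp_def] using
          (hψdiff (x t)).hasGradientAt.hasFDerivAt.comp_hasDerivWithinAt t (hx' t ht)
      exact (((hx'' t ht).inner ℝ h1).add ((h1.inner ℝ h1).const_mul _)).add
        ((((((hx'' t ht).inner ℝ (hx'' t ht)).const_mul _).add hφ').add
          ((hβderiv t ht).mul hψ')).const_mul a)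
    have hfc : ContinuousOn (fun t => ⟪q, x t - z⟫ - β t * ψ (x t)) (Ici 0) := by
      have hxc : ContinuousOn x (Ici 0) := fun t ht => (hx' t ht).continuousWithinAt
      have hβc : ContinuousOn β (Ici 0) := fun t ht => (hβderiv t ht).continuousWithinAt
      exact (continuousOn_const.inner (hxc.sub continuousOn_const)).sub
        (hβc.mul (hψdiff.continuous.comp_continuousOn hxc))
    have hfin : ∫⁻ t in Ici (0 : ℝ), ENNReal.ofReal (⟪q, x t - z⟫ - β t * ψ (x t)) ≠ ⊤ := by
      refine ne_top_of_le_ne_top (hH z q hz (hnormal _ (inv_nonneg.2 hδ.le)))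
        (setLIntegral_mono' measurableSet_Ici fun t ht => ?_)
      refine le_trans (le_of_eq ?_) (le_iSup _ (x t))
      rw [hexpr q (x t) t ht]
    obtain ⟨C, hC⟩ := exists_forall_le_of_hasDerivWithinAt_le hδ.le hderiv hfc (by
      intro t ht
      have hx''eq : x'' t = -(γ • x' t + gradient φ (x t) + β t • gradient ψ (x t)) := by
        rw [eq_neg_iff_add_eq_zero, ← hode t ht]; abel
      have hqc : (1 - a * k) * ⟪q, x t - z⟫ = -⟪gradient φ z, x t - z⟫ := by
        rw [hq, real_inner_smul_left, inner_neg_left, mul_inv_cancel_left₀ hδ.ne']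
      have hφ1 := hφconv.add_inner_gradient_le hφdiff (x t) z
      have hφ2 := hφconv.add_inner_gradient_le hφdiff z (x t)
      have hψ1 := hψconv.add_inner_gradient_le hψdiff (x t) z
      rw [← neg_sub (x t) z, inner_neg_right] at hφ1 hψ1
      have h1 := mul_le_mul_of_nonneg_left hψ1 (hβpos t ht).le
      have h2 := mul_le_mul_of_nonneg_left
        (mul_le_mul_of_nonneg_right (hβgrowth t ht).2 (hψnonneg (x t))) ha0.le
      have h3 := mul_le_mul_of_nonneg_right haγ (real_inner_self_nonneg (x := x' t))
      rw [mul_sub, hqc, real_inner_comm (x'' t) (x' t), real_inner_comm (x' t) (x t - z), hx''eq]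
      simp only [inner_neg_left, inner_add_left, real_inner_smul_left]
      rw [hz] at h1
      nlinarith) hfin
    refine ⟨(C - a * m) / a, fun t ht => ?_⟩
    rw [le_div_iff₀ ha0]
    have h := hC t ht
    have hsq : 0 ≤ ⟪x' t + γ • (x t - z), x' t + γ • (x t - z)⟫ := real_inner_self_nonneg
    rw [inner_add_left, inner_add_right, inner_add_right, real_inner_smul_left,
      real_inner_smul_left, real_inner_smul_right, real_inner_smul_right,
      real_inner_comm (x' t) (x t - z)] at hsq
    have hx'0 : 0 ≤ ⟪x' t, x' t⟫ := real_inner_self_nonneg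
    have h2 := mul_le_mul_of_nonneg_left (hm (x t)) ha0.le
    have h3 : 0 ≤ ⟪x' t, x t - z⟫ + γ / 2 * ⟪x t - z, x t - z⟫ +
        a / 2 * ⟪x' t, x' t⟫ := by
      refine nonneg_of_mul_nonneg_right (a := 2 * γ) ?_ (by positivity)
      nlinarith [mul_le_mul_of_nonneg_right haγ hx'0, hsq, real_inner_comm (x' t) (x t - z)]
    nlinarith
  -- hence `ψ(x)` tends to zero, and Young's inequality at a fixed time bounds the linear term
  obtain ⟨s, hs, hMs⟩ := exists_lt_of_lintegral_Ici_ne_top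
    (hH z ((1 : ℝ) • -gradient φ z) hz (hnormal 1 zero_le_one)) (half_pos hε)
  have hyoung : ∀ w, -⟪gradient φ z, w - z⟫ - β s * ψ w < ε / 2 := by
    intro w
    have h := (le_iSup (fun w => ENNReal.ofReal
      (β s * ((⟪(β s)⁻¹ • ((1 : ℝ) • -gradient φ z), w⟫ - ψ w) -
        ⟪(β s)⁻¹ • ((1 : ℝ) • -gradient φ z), z⟫))) w).trans_lt hMs
    rw [hexpr _ w s hs, one_smul, inner_neg_left] at h
    exact (ENNReal.ofReal_lt_ofReal_iff (half_pos hε)).1 h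
  filter_upwards [hβinf.eventually_gt_atTop (β s * C / (ε / 2)), eventually_ge_atTop 0]
    with t hβt ht
  rw [div_lt_iff₀ (half_pos hε)] at hβt
  have h1 := mul_le_mul_of_nonneg_left (hC t ht) (hβpos s hs).le
  have h2 : β s * ψ (x t) < ε / 2 := by
    refine lt_of_mul_lt_mul_left (a := β t) ?_ (hβpos t ht).le
    linarith
  linarith [hyoung (x t), hφconv.add_inner_gradient_le hφdiff z (x t)]
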